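/- In the ordered Chinese Restaurant Process chain of ordered set partitions of {1,…,n}, for every 1 ≤ n₁ ≤ n, the probability that the element 1 lies in the left-most block and that this block has size n₁ equals C(n−1, n−n₁) · [1−α]_{n₁−1} · [θ]_{n−n₁} / [1+θ]_{n−1}, where C(a,b) is the binomial coefficient and [x]_j = x(x+1)⋯(x+j−1) is the rising factorial, with [x]_0 = 1. -/

import Mathlib

/-- Rising factorial `[x]_j = x (x+1) ⋯ (x+j-1)`, with `[x]_0 = 1`. -/
noncomputable def risingFactorial (x : ℝ) : ℕ → ℝ
  | 0 => 1
  | n + 1 => risingFactorial x n * (x + n)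

/-- The law of the ordered set partition `Π̃_n` of `{1,…,n}` generated by the ordered
Chinese Restaurant Process with parameters `(α, θ)`: `Π̃₀` is the empty list; given
`Π̃_n = (B₁,…,B_k)`, customer `n+1` joins block `B_j` with probability
`(|B_j|−α)/(n+θ)`, forms a new singleton block inserted immediately to the left of `B_j`
with probability `α/(n+θ)`, and forms a new singleton block appended at the right end
with probability `θ/(n+θ)`.  (In particular `Π̃₁ = ({1})` almost surely.)  The recursion
computes the probability mass function by locating the block of `P` containing the last
customer `n+1`. -/
noncomputable def ocrpPartLaw (α θ : ℝ) : ℕ → List (Finset ℕ) → ℝ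
  | 0, P => if P = [] then 1 else 0
  | n + 1, P =>
      ∑ j ∈ Finset.range P.length,
        (if n + 1 ∈ P.getD j ∅ then
          (if P.getD j ∅ = {n + 1} then
            (if j + 1 = P.length then ocrpPartLaw α θ n (P.eraseIdx j) * (θ / ((n : ℝ) + θ))
             else ocrpPartLaw α θ n (P.eraseIdx j) * (α / ((n : ℝ) + θ)))
          else
            ocrpPartLaw α θ n (P.set j (P.getD j ∅ \ {n + 1})) *
              ((((P.getD j ∅).card : ℝ) - 1 - α) / ((n : ℝ) + θ)))
        else 0)

/-- The transition kernel of the ordered Chinese Restaurant Process: the law of `Π̃_{n+1}` given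
`Π̃_n = Q`. Appending a block at the right end is inserting it at index `Q.length`. -/
noncomputable def ocrpKernel (α θ : ℝ) (n : ℕ) (Q : List (Finset ℕ)) : List (Finset ℕ) →₀ ℝ :=
  ∑ j ∈ Finset.range Q.length,
      Finsupp.single (Q.set j (insert (n + 1) (Q.getD j ∅)))
        ((((Q.getD j ∅).card : ℝ) - α) / ((n : ℝ) + θ))
    + ∑ j ∈ Finset.range (Q.length + 1),
      Finsupp.single (Q.insertIdx j {n + 1}) ((if j = Q.length then θ else α) / ((n : ℝ) + θ))

/-- The law of `Π̃_n` as a finitely supported function, built forward in time. -/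
noncomputable def ocrpFinsupp (α θ : ℝ) : ℕ → List (Finset ℕ) →₀ ℝ
  | 0 => Finsupp.single [] 1
  | n + 1 => Finsupp.linearCombination ℝ (ocrpKernel α θ n) (ocrpFinsupp α θ n)

/-- The properties of ordered set partitions of `{1,…,n}` used below: the blocks are nonempty,
bounded by `n`, and their sizes add up to `n`. -/
structure IsBlockList (n : ℕ) (Q : List (Finset ℕ)) : Prop where
  nonempty : ∀ B ∈ Q, B.Nonempty
  le : ∀ B ∈ Q, ∀ x ∈ B, x ≤ n
  sum_card : (Q.map Finset.card).sum = n

/-- The indicator function of the event that `1` lies in a left-most block of size `m`. -/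
noncomputable def leftmostIndicator (m : ℕ) (P : List (Finset ℕ)) : ℝ :=
  if 1 ∈ P.getD 0 ∅ ∧ (P.getD 0 ∅).card = m then 1 else 0

theorem List.sum_map_set_getD {ι : Type*} (f : ι → ℕ) (d b : ι) (k : ℕ) :
    ∀ (Q : List ι) (j : ℕ), j < Q.length → f b = f (Q.getD j d) + k →
      ((Q.set j b).map f).sum = (Q.map f).sum + k
  | [], j, hj, _ => by simp at hj
  | a :: Q, 0, _, h => by
      simp only [List.getD_cons_zero] at h
      simp [h, add_right_comm]
  | a :: Q, j + 1, hj, h => by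
      have := List.sum_map_set_getD f d b k Q j (by simpa using hj) (by simpa using h)
      rw [List.set_cons_succ, List.map_cons, List.sum_cons, this, List.map_cons, List.sum_cons,
        add_assoc]

theorem List.getD_mem_of_lt {ι : Type*} (d : ι) {Q : List ι} {j : ℕ} (hj : j < Q.length) :
    Q.getD j d ∈ Q := by
  rw [List.getD_eq_getElem _ _ hj]
  exact List.getElem_mem hj

theorem List.getD_set_self {ι : Type*} (d b : ι) {Q : List ι} {j : ℕ} (hj : j < Q.length) :
    (Q.set j b).getD j d = b := by
  rw [List.getD_eq_getElem _ _ (by simpa using hj), List.getElem_set_self]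

theorem IsBlockList.notMem_getD {n : ℕ} {Q : List (Finset ℕ)} (h : IsBlockList n Q) {j : ℕ}
    (hj : j < Q.length) : n + 1 ∉ Q.getD j ∅ := fun hx => by
  have := h.le _ (List.getD_mem_of_lt ∅ hj) _ hx
  omega

theorem IsBlockList.set {n : ℕ} {Q : List (Finset ℕ)} (h : IsBlockList n Q) {j : ℕ}
    (hj : j < Q.length) : IsBlockList (n + 1) (Q.set j (insert (n + 1) (Q.getD j ∅))) where
  nonempty B hB := by
    rcases List.mem_or_eq_of_mem_set hB with hB | rfl
    · exact h.nonempty B hB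
    · simp
  le B hB x hx := by
    rcases List.mem_or_eq_of_mem_set hB with hB | rfl
    · exact (h.le B hB x hx).trans n.le_succ
    · rcases Finset.mem_insert.1 hx with rfl | hx
      · exact le_rfl
      · exact (h.le _ (List.getD_mem_of_lt ∅ hj) x hx).trans n.le_succ
  sum_card := by
    rw [List.sum_map_set_getD Finset.card ∅ _ 1 Q j hj
      (Finset.card_insert_of_notMem (h.notMem_getD hj)), h.sum_card]

theorem IsBlockList.insertIdx {n : ℕ} {Q : List (Finset ℕ)} (h : IsBlockList n Q) {j : ℕ}
    (hj : j ≤ Q.length) : IsBlockList (n + 1) (Q.insertIdx j {n + 1}) where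
  nonempty B hB := by
    rcases (List.mem_insertIdx hj).1 hB with rfl | hB
    · simp
    · exact h.nonempty B hB
  le B hB x hx := by
    rcases (List.mem_insertIdx hj).1 hB with rfl | hB
    · exact (Finset.mem_singleton.1 hx).le
    · exact (h.le B hB x hx).trans n.le_succ
  sum_card := by
    rw [((List.perm_insertIdx _ _ hj).map Finset.card).sum_eq]
    simp [h.sum_card, add_comm]

theorem ocrpKernel_apply (α θ : ℝ) (n : ℕ) (Q P : List (Finset ℕ)) :
    ocrpKernel α θ n Q P =
      ∑ j ∈ Finset.range P.length,
        ((if j < Q.length ∧ Q.set j (insert (n + 1) (Q.getD j ∅)) = P then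
            (((Q.getD j ∅).card : ℝ) - α) / ((n : ℝ) + θ) else 0)
          + (if j ≤ Q.length ∧ Q.insertIdx j {n + 1} = P then
            (if j = Q.length then θ else α) / ((n : ℝ) + θ) else 0)) := by
  rw [ocrpKernel, Finsupp.add_apply, Finsupp.finsetSum_apply, Finsupp.finsetSum_apply,
    Finset.sum_add_distrib]
  simp only [Finsupp.single_apply]
  congr 1
  · by_cases hl : Q.length = P.length
    · rw [hl]
      refine Finset.sum_congr rfl fun j hj => ?_
      simp [Finset.mem_range.1 hj]
    · have hne : ∀ j b, Q.set j b ≠ P := fun j b hb => hl (by rw [← hb, List.length_set])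
      simp [hne]
  · by_cases hl : Q.length + 1 = P.length
    · rw [hl]
      refine Finset.sum_congr rfl fun j hj => ?_
      have : j ≤ Q.length := by have := Finset.mem_range.1 hj; omega
      simp [this]
    · have hne : ∀ j, j ≤ Q.length → Q.insertIdx j {n + 1} ≠ P := fun j hj hb =>
        hl (by rw [← hb, List.length_insertIdx_of_le_length hj])
      rw [Finset.sum_eq_zero, Finset.sum_eq_zero]
      · intro j _
        rw [if_neg fun h => hne j h.1 h.2]
      · intro j hj
        rw [if_neg (hne j (by have := Finset.mem_range.1 hj; omega))]

theorem isBlockList_of_ocrpKernel_ne_zero {α θ : ℝ} {n : ℕ} {Q P : List (Finset ℕ)}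
    (hQ : IsBlockList n Q) (h : ocrpKernel α θ n Q P ≠ 0) : IsBlockList (n + 1) P := by
  rw [ocrpKernel_apply] at h
  obtain ⟨j, -, hj⟩ := Finset.exists_ne_zero_of_sum_ne_zero h
  by_cases h1 : j < Q.length ∧ Q.set j (insert (n + 1) (Q.getD j ∅)) = P
  · exact h1.2 ▸ hQ.set h1.1
  · rw [if_neg h1, zero_add] at hj
    have h2 := (ite_ne_right_iff.1 hj).1
    exact h2.2 ▸ hQ.insertIdx h2.1

theorem ocrpFinsupp_succ_apply (α θ : ℝ) (n : ℕ) (P : List (Finset ℕ)) :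
    ocrpFinsupp α θ (n + 1) P =
      ∑ Q ∈ (ocrpFinsupp α θ n).support, ocrpFinsupp α θ n Q * ocrpKernel α θ n Q P := by
  rw [ocrpFinsupp, Finsupp.linearCombination_apply, Finsupp.sum, Finsupp.finsetSum_apply]
  rfl

theorem isBlockList_of_mem_support (α θ : ℝ) : ∀ (n : ℕ) (P : List (Finset ℕ)),
    P ∈ (ocrpFinsupp α θ n).support → IsBlockList n P
  | 0, P, hP => by
      have : P = [] := by
        simpa [ocrpFinsupp] using hP
      subst this
      exact ⟨by simp, by simp, by simp⟩
  | n + 1, P, hP => by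
      rw [Finsupp.mem_support_iff, ocrpFinsupp_succ_apply] at hP
      obtain ⟨Q, hQ, hne⟩ := Finset.exists_ne_zero_of_sum_ne_zero hP
      exact isBlockList_of_ocrpKernel_ne_zero (isBlockList_of_mem_support α θ n Q hQ)
        (right_ne_zero_of_mul hne)

theorem set_insert_eq_iff {n j : ℕ} {Q P : List (Finset ℕ)} (hQ : IsBlockList n Q)
    (hj : j < P.length) :
    (j < Q.length ∧ Q.set j (insert (n + 1) (Q.getD j ∅)) = P) ↔
      (n + 1 ∈ P.getD j ∅ ∧ P.getD j ∅ ≠ {n + 1}) ∧ P.set j (P.getD j ∅ \ {n + 1}) = Q := by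
  constructor
  · rintro ⟨hjQ, rfl⟩
    have hn := hQ.notMem_getD hjQ
    rw [List.getD_set_self _ _ hjQ]
    refine ⟨⟨Finset.mem_insert_self _ _, fun he => ?_⟩, ?_⟩
    · obtain ⟨x, hx⟩ := hQ.nonempty _ (List.getD_mem_of_lt ∅ hjQ)
      have : x = n + 1 := Finset.mem_singleton.1 (he ▸ Finset.mem_insert_of_mem hx)
      exact hn (this ▸ hx)
    · rw [Finset.sdiff_singleton_eq_erase, Finset.erase_insert hn, List.set_set,
        List.getD_eq_getElem _ _ hjQ, List.set_getElem_self]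
  · rintro ⟨⟨hm, -⟩, rfl⟩
    refine ⟨by simpa using hj, ?_⟩
    rw [List.getD_set_self _ _ hj, Finset.sdiff_singleton_eq_erase, Finset.insert_erase hm, List.set_set,
      List.getD_eq_getElem _ _ hj, List.set_getElem_self]

theorem insertIdx_singleton_eq_iff {n j : ℕ} {Q P : List (Finset ℕ)} (hj : j < P.length) :
    (j ≤ Q.length ∧ Q.insertIdx j {n + 1} = P) ↔
      P.getD j ∅ = {n + 1} ∧ P.eraseIdx j = Q := by
  constructor
  · rintro ⟨hjQ, rfl⟩
    refine ⟨?_, List.eraseIdx_insertIdx_self _⟩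
    rw [List.getD_eq_getElem _ _ hj, List.getElem_insertIdx_self]
  · rintro ⟨hg, rfl⟩
    refine ⟨by rw [List.length_eraseIdx_of_lt hj]; omega, ?_⟩
    rw [← hg, List.getD_eq_getElem _ _ hj, List.insertIdx_eraseIdx_getElem]

theorem Finsupp.sum_support_ite_eq {ι : Type*} [DecidableEq ι] (μ : ι →₀ ℝ) (a : ι) (c : ℝ) :
    ∑ Q ∈ μ.support, (if a = Q then μ Q * c else 0) = μ a * c := by
  rw [Finset.sum_ite_eq]
  split_ifs with h
  · rfl
  · rw [Finsupp.notMem_support_iff.1 h, zero_mul]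

theorem ocrpFinsupp_eq (α θ : ℝ) : ∀ (n : ℕ) (P : List (Finset ℕ)),
    ocrpFinsupp α θ n P = ocrpPartLaw α θ n P
  | 0, P => by
      simp [ocrpFinsupp, ocrpPartLaw, Finsupp.single_apply, eq_comm]
  | n + 1, P => by
      rw [ocrpFinsupp_succ_apply, ocrpPartLaw]
      simp only [ocrpKernel_apply, Finset.mul_sum]
      rw [Finset.sum_comm]
      refine Finset.sum_congr rfl fun j hj => ?_
      rw [Finset.mem_range] at hj
      simp only [← ocrpFinsupp_eq α θ n]
      have hlen : (P.eraseIdx j).length + 1 = P.length := by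
        rw [List.length_eraseIdx_of_lt hj]; omega
      by_cases hm : n + 1 ∈ P.getD j ∅
      · by_cases hs : P.getD j ∅ = {n + 1}
        · rw [if_pos hm, if_pos hs]
          have : ∀ c₁ c₂ : ℝ, (if j + 1 = P.length then c₁ else c₂)
              = if j = (P.eraseIdx j).length then c₁ else c₂ := fun c₁ c₂ => by
            congr 1; exact propext (by omega)
          rw [this, ← mul_ite, ← ite_div, ← Finsupp.sum_support_ite_eq]
          refine Finset.sum_congr rfl fun Q hQ => ?_
          rw [if_neg ((set_insert_eq_iff (isBlockList_of_mem_support α θ n Q hQ) hj).not.2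
            fun h => h.1.2 hs), zero_add]
          simp only [insertIdx_singleton_eq_iff hj, hs, true_and]
          by_cases h : P.eraseIdx j = Q
          · subst h
            simp
          · simp [h]
        · rw [if_pos hm, if_neg hs, ← Finsupp.sum_support_ite_eq]
          refine Finset.sum_congr rfl fun Q hQ => ?_
          rw [if_neg ((insertIdx_singleton_eq_iff hj).not.2 fun h => hs h.1), add_zero]
          simp only [set_insert_eq_iff (isBlockList_of_mem_support α θ n Q hQ) hj]
          by_cases h : P.set j (P.getD j ∅ \ {n + 1}) = Q
          · rw [if_pos ⟨⟨hm, hs⟩, h⟩, if_pos h, ← h,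
              List.getD_set_self _ _ hj,
              Finset.sdiff_singleton_eq_erase, ← Finset.card_erase_add_one hm]
            push_cast
            ring
          · rw [if_neg fun h' => h h'.2, if_neg h, mul_zero]
      · rw [if_neg hm]
        refine Finset.sum_eq_zero fun Q hQ => ?_
        rw [if_neg ((set_insert_eq_iff (isBlockList_of_mem_support α θ n Q hQ) hj).not.2
            fun h => hm h.1.1),
          if_neg ((insertIdx_singleton_eq_iff hj).not.2 fun h => hm (h.1 ▸ Finset.mem_singleton_self _))]
        simp

/-- The probability that `1` lies in the left-most block of `Π̃_n` and that this block has
size `m`. -/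
noncomputable def leftmostProb (α θ : ℝ) (n m : ℕ) : ℝ :=
  Finsupp.linearCombination ℝ (leftmostIndicator m) (ocrpFinsupp α θ n)

theorem tsum_ocrpPartLaw_eq_leftmostProb (α θ : ℝ) (n m : ℕ) :
    (∑' P : {P : List (Finset ℕ) // 1 ∈ P.getD 0 ∅ ∧ (P.getD 0 ∅).card = m},
      ocrpPartLaw α θ n P.val) = leftmostProb α θ n m := by
  have h := tsum_subtype {P : List (Finset ℕ) | 1 ∈ P.getD 0 ∅ ∧ (P.getD 0 ∅).card = m}
    (ocrpPartLaw α θ n)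
  refine h.trans ?_
  rw [tsum_eq_sum (s := (ocrpFinsupp α θ n).support), leftmostProb,
    Finsupp.linearCombination_apply, Finsupp.sum]
  · refine Finset.sum_congr rfl fun P _ => ?_
    simp [Set.indicator_apply, leftmostIndicator, ocrpFinsupp_eq]
  · intro P hP
    rw [Finsupp.notMem_support_iff, ocrpFinsupp_eq] at hP
    simp [Set.indicator_apply, hP]

theorem List.sum_range_getD_card (Q : List (Finset ℕ)) :
    ∑ j ∈ Finset.range Q.length, ((Q.getD j ∅).card : ℝ) = ((Q.map Finset.card).sum : ℕ) := by
  induction Q with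
  | nil => simp
  | cons B Q ih =>
      rw [List.length_cons, Finset.sum_range_succ']
      simp only [List.getD_cons_succ, List.getD_cons_zero, ih, List.map_cons, List.sum_cons]
      push_cast
      ring

theorem linearCombination_leftmostIndicator_ocrpKernel (α θ : ℝ) {n : ℕ} (hn : n ≠ 0) (m : ℕ)
    {Q : List (Finset ℕ)} (hQ : IsBlockList n Q) :
    Finsupp.linearCombination ℝ (leftmostIndicator (m + 1)) (ocrpKernel α θ n Q) =
      leftmostIndicator m Q * ((m - α) / (n + θ))
        + leftmostIndicator (m + 1) Q * ((n - (m + 1) + θ) / (n + θ)) := by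
  cases Q with
  | nil => exact absurd hQ.sum_card (by simpa using hn.symm)
  | cons B Q =>
    have hB : n + 1 ∉ B := by simpa using hQ.notMem_getD (j := 0) (by simp)
    have hsum : (B.card : ℝ) + ((Q.map Finset.card).sum : ℕ) = n := by
      have := hQ.sum_card
      rw [List.map_cons, List.sum_cons] at this
      exact_mod_cast this
    have hcons : ∀ (Q' : List (Finset ℕ)) (k : ℕ), leftmostIndicator k (B :: Q')
        = if 1 ∈ B ∧ B.card = k then 1 else 0 := fun _ _ => rfl
    have hgrow : leftmostIndicator (m + 1) (insert (n + 1) B :: Q)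
        = leftmostIndicator m (B :: Q) := by
      simp [leftmostIndicator, Finset.card_insert_of_notMem hB, hn]
    have hnew : leftmostIndicator (m + 1) ({n + 1} :: B :: Q) = 0 := by
      simp [leftmostIndicator, hn]
    rw [ocrpKernel, map_add, map_sum, map_sum]
    simp only [Finsupp.linearCombination_single, smul_eq_mul]
    rw [List.length_cons, Finset.sum_range_succ', Finset.sum_range_succ']
    simp only [List.getD_cons_succ, List.getD_cons_zero, List.set_cons_succ, List.set_cons_zero,
      List.insertIdx_succ_cons, List.insertIdx_zero, hgrow, hnew, hcons, ← Finset.sum_mul,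
      ← Finset.sum_div, Finset.sum_sub_distrib, List.sum_range_getD_card]
    rw [Finset.sum_range_succ, Finset.sum_congr rfl (g := fun _ => α) fun j hj => if_neg (by
      have := Finset.mem_range.1 hj; omega)]
    simp only [Finset.sum_const, Finset.card_range, nsmul_eq_mul, if_true, ← hsum]
    by_cases h1 : 1 ∈ B
    · by_cases hm : B.card = m
      · simp [h1, hm]
      · by_cases hm' : B.card = m + 1
        · simp [h1, hm']
          ring
        · simp [h1, hm, hm']
    · simp [h1]

theorem leftmostProb_succ (α θ : ℝ) {n : ℕ} (hn : n ≠ 0) (m : ℕ) :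
    leftmostProb α θ (n + 1) (m + 1) =
      leftmostProb α θ n m * ((m - α) / (n + θ))
        + leftmostProb α θ n (m + 1) * ((n - (m + 1) + θ) / (n + θ)) := by
  rw [leftmostProb, ocrpFinsupp, leftmostProb, leftmostProb]
  simp only [Finsupp.linearCombination_apply (R := ℝ) (v := ocrpKernel α θ n), Finsupp.sum,
    map_sum, map_smul]
  simp only [Finsupp.linearCombination_apply _ (ocrpFinsupp α θ n), Finsupp.sum, Finset.sum_mul,
    ← Finset.sum_add_distrib]
  refine Finset.sum_congr rfl fun Q hQ => ?_
  rw [linearCombination_leftmostIndicator_ocrpKernel α θ hn m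
    (isBlockList_of_mem_support α θ n Q hQ)]
  simp only [smul_eq_mul]
  ring

theorem leftmostProb_zero_right (α θ : ℝ) (n : ℕ) : leftmostProb α θ n 0 = 0 := by
  have : leftmostIndicator 0 = 0 := by
    ext P
    refine if_neg fun h => ?_
    exact Finset.notMem_empty 1 (Finset.card_eq_zero.1 h.2 ▸ h.1)
  simp [leftmostProb, this]

theorem leftmostProb_one (α : ℝ) {θ : ℝ} (hθ : θ ≠ 0) (m : ℕ) :
    leftmostProb α θ 1 (m + 1) = if m = 0 then 1 else 0 := by
  simp [leftmostProb, ocrpFinsupp, ocrpKernel, leftmostIndicator, hθ]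

theorem risingFactorial_pos {x : ℝ} (hx : 0 < x) : ∀ n, 0 < risingFactorial x n
  | 0 => one_pos
  | n + 1 => mul_pos (risingFactorial_pos hx n) (by positivity)

theorem leftmostProb_eq (α : ℝ) {θ : ℝ} (hθ : 0 < θ) (n : ℕ) : ∀ m : ℕ,
    leftmostProb α θ (n + 1) (m + 1) = (n.choose m : ℝ) * risingFactorial (1 - α) m
      * risingFactorial θ (n - m) / risingFactorial (1 + θ) n := by
  induction n with
  | zero =>
      intro m
      rw [zero_add, leftmostProb_one α hθ.ne']
      cases m <;> simp [risingFactorial]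
  | succ n ih =>
      intro m
      have hpos := risingFactorial_pos (x := 1 + θ) (by linarith) n
      have hden : (0 : ℝ) < 1 + θ + n := by positivity
      have hden' : ((n + 1 : ℕ) : ℝ) + θ = 1 + θ + n := by push_cast; ring
      rw [leftmostProb_succ α θ n.succ_ne_zero, ih m, hden']
      cases m with
      | zero =>
          rw [leftmostProb_zero_right]
          simp only [Nat.choose_zero_right, Nat.sub_zero, risingFactorial]
          push_cast
          field_simp
          ring
      | succ m =>
          rw [ih m, Nat.choose_succ_succ, Nat.succ_sub_succ]
          rcases lt_or_ge m n with h | h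
          · obtain ⟨k, rfl⟩ := Nat.exists_eq_add_of_lt h
            rw [show m + k + 1 - m = k + 1 by omega, show m + k + 1 - (m + 1) = k by omega]
            simp only [risingFactorial] at hpos ⊢
            push_cast at hden ⊢
            field_simp
            ring
          · rw [Nat.choose_eq_zero_of_lt (by omega : n < m + 1)]
            simp only [risingFactorial]
            push_cast
            field_simp
            ring

/-- the probability that `1` lies in the left-most block of `Π̃_n` and that
this block has size `n₁` equals `C(n−1, n−n₁) · [1−α]_{n₁−1} · [θ]_{n−n₁} / [1+θ]_{n−1}`. -/
theorem ocrpPart_one_in_leftmost_block (α θ : ℝ) (hα0 : 0 < α) (hα1 : α < 1) (hθ : 0 < θ)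
    (n n₁ : ℕ) (h1 : 1 ≤ n₁) (h2 : n₁ ≤ n) :
    (∑' P : {P : List (Finset ℕ) // 1 ∈ P.getD 0 ∅ ∧ (P.getD 0 ∅).card = n₁},
        ocrpPartLaw α θ n P.val)
      = ((n - 1).choose (n - n₁) : ℝ) * risingFactorial (1 - α) (n₁ - 1)
          * risingFactorial θ (n - n₁) / risingFactorial (1 + θ) (n - 1) := by
  obtain ⟨m, rfl⟩ := Nat.exists_eq_add_of_le' h1
  obtain ⟨k, rfl⟩ := Nat.exists_eq_add_of_le' (h1.trans h2)
  rw [tsum_ocrpPartLaw_eq_leftmostProb, leftmostProb_eq α hθ, Nat.add_sub_cancel,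
    Nat.add_sub_cancel, Nat.add_sub_add_right, Nat.choose_symm (by omega)]
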